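/- Let σ, τ₀, τ₁ be 3×3 permutation matrices and let i : ℕ → {0,1} be eventually periodic. Suppose the nested Farey triangles satisfy ⋂ₙ Δ_{(σ,τ₀,τ₁)}(i₁,…,iₙ) = {(α, β)} and the nested barycentric triangles satisfy ⋂ₙ Γ_{(σ,τ₀,τ₁)}(i₁,…,iₙ) = {(r, s)}. Then there is a subfield K of ℝ with [K : ℚ] ≤ 3 such that α, β ∈ K, and r and s are rational numbers. -/

import Mathlib

open Matrix MeasureTheory Filter

noncomputable section

/-- Projection π(a,b,c) = (b/a, c/a). -/
def projPt (v : Fin 3 → ℝ) : ℝ × ℝ := (v 1 / v 0, v 2 / v 0)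

def Vmat : Matrix (Fin 3) (Fin 3) ℝ := !![1,1,1; 0,1,1; 0,0,1]

def prodSeq (C : Fin 2 → Matrix (Fin 3) (Fin 3) ℝ) (i : ℕ → Fin 2) :
    ℕ → Matrix (Fin 3) (Fin 3) ℝ
  | 0 => 1
  | n + 1 => prodSeq C i n * C (i (n + 1))

/-- The subtriangle: convex hull of the π-images of the columns of V·C_{i₁}⋯C_{iₙ}. -/
def subTri (C : Fin 2 → Matrix (Fin 3) (Fin 3) ℝ) (i : ℕ → Fin 2) (n : ℕ) :
    Set (ℝ × ℝ) :=
  convexHull ℝ (Set.range fun j : Fin 3 => projPt fun k => (Vmat * prodSeq C i n) k j)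

/-- The permutation matrix of a permutation of {0,1,2}. -/
def permMat (p : Equiv.Perm (Fin 3)) : Matrix (Fin 3) (Fin 3) ℝ :=
  Matrix.of fun i j => if p j = i then 1 else 0

def F0 : Matrix (Fin 3) (Fin 3) ℝ := !![0,0,1; 1,0,0; 0,1,1]
def F1 : Matrix (Fin 3) (Fin 3) ℝ := !![1,0,1; 0,1,0; 0,0,1]
def G0 : Matrix (Fin 3) (Fin 3) ℝ := !![0,0,1/2; 1,0,0; 0,1,1/2]
def G1 : Matrix (Fin 3) (Fin 3) ℝ := !![1,0,1/2; 0,1,0; 0,0,1/2]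

def Ftrip (σ τ0 τ1 : Matrix (Fin 3) (Fin 3) ℝ) : Fin 2 → Matrix (Fin 3) (Fin 3) ℝ :=
  ![σ * F0 * τ0, σ * F1 * τ1]

def Gtrip (σ τ0 τ1 : Matrix (Fin 3) (Fin 3) ℝ) : Fin 2 → Matrix (Fin 3) (Fin 3) ℝ :=
  ![σ * G0 * τ0, σ * G1 * τ1]


theorem cone_of_mem_hull (M : Matrix (Fin 3) (Fin 3) ℝ) (hM : ∀ j, 0 < M 0 j) (x : ℝ × ℝ)
    (hx : x ∈ convexHull ℝ (Set.range fun j : Fin 3 => projPt fun k => M k j)) :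
    ∃ w : Fin 3 → ℝ, (∀ j, 0 ≤ w j) ∧ M *ᵥ w = ![1, x.1, x.2] := by
  have hsub : convexHull ℝ (Set.range fun j : Fin 3 => projPt fun k => M k j) ⊆
      {x : ℝ × ℝ | ∃ w : Fin 3 → ℝ, (∀ j, 0 ≤ w j) ∧ M *ᵥ w = ![1, x.1, x.2]} := by
    apply convexHull_min
    · rintro _ ⟨j, rfl⟩
      refine ⟨Pi.single j (M 0 j)⁻¹, ?_, ?_⟩
      · intro l
        by_cases h : l = j
        · subst h; simp [(hM l).le]
        · simp [h]
      · have := (hM j).ne'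
        rw [Matrix.mulVec_single]
        ext k
        fin_cases k <;> simp [projPt, this, div_eq_mul_inv]
    · rintro x ⟨w, hw, hwx⟩ y ⟨z, hz, hzy⟩ a b ha hb hab
      refine ⟨a • w + b • z, fun j => ?_, ?_⟩
      · simp only [Pi.add_apply, Pi.smul_apply, smul_eq_mul]
        exact add_nonneg (mul_nonneg ha (hw j)) (mul_nonneg hb (hz j))
      · rw [Matrix.mulVec_add, Matrix.mulVec_smul, Matrix.mulVec_smul, hwx, hzy]
        ext k
        fin_cases k <;> simp [hab]
  exact hsub hx

theorem mem_hull_of_cone (M : Matrix (Fin 3) (Fin 3) ℝ) (hM : ∀ j, 0 < M 0 j)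
    (w : Fin 3 → ℝ) (hw : ∀ j, 0 ≤ w j) (hpos : 0 < (M *ᵥ w) 0) :
    projPt (M *ᵥ w) ∈ convexHull ℝ (Set.range fun j : Fin 3 => projPt fun k => M k j) := by
  refine mem_convexHull_of_exists_fintype (ι := Fin 3)
    (fun j => w j * M 0 j / (M *ᵥ w) 0) (fun j => projPt fun k => M k j) ?_ ?_ ?_ ?_
  · intro j
    exact div_nonneg (mul_nonneg (hw j) (hM j).le) hpos.le
  · rw [← Finset.sum_div, div_eq_one_iff_eq hpos.ne']
    simp [Matrix.mulVec, dotProduct, mul_comm]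
  · intro j; exact ⟨j, rfl⟩
  · have h0 := (hM 0).ne'
    have h1 := (hM 1).ne'
    have h2 := (hM 2).ne'
    have hp := hpos.ne'
    generalize hd : (M *ᵥ w) 0 = d at *
    ext
    · simp only [projPt, hd, Fin.sum_univ_three, Prod.fst_add, Prod.smul_fst, smul_eq_mul]
      simp only [Matrix.mulVec, dotProduct, Fin.sum_univ_three]
      field_simp
    · simp only [projPt, hd, Fin.sum_univ_three, Prod.snd_add, Prod.smul_snd, smul_eq_mul]
      simp only [Matrix.mulVec, dotProduct, Fin.sum_univ_three]
      field_simp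

/-- Nonnegative invertible matrices. -/
def goodMon : Submonoid (Matrix (Fin 3) (Fin 3) ℝ) where
  carrier := {A | (∀ i j, 0 ≤ A i j) ∧ A.det ≠ 0}
  one_mem' := ⟨fun i j => by rw [Matrix.one_apply]; split_ifs <;> norm_num, by simp⟩
  mul_mem' := by
    rintro A B ⟨hA, hA'⟩ ⟨hB, hB'⟩
    refine ⟨fun i j => ?_, ?_⟩
    · rw [Matrix.mul_apply]
      exact Finset.sum_nonneg fun l _ => mul_nonneg (hA i l) (hB l j)
    · rw [Matrix.det_mul]; exact mul_ne_zero hA' hB'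

/-- Matrices with rational entries. -/
def ratMon : Submonoid (Matrix (Fin 3) (Fin 3) ℝ) where
  carrier := {A | ∃ B : Matrix (Fin 3) (Fin 3) ℚ, B.map (algebraMap ℚ ℝ) = A}
  one_mem' := ⟨1, by simp⟩
  mul_mem' := by
    rintro _ _ ⟨A, rfl⟩ ⟨B, rfl⟩
    exact ⟨A * B, by rw [Matrix.map_mul]⟩

/-- Column-stochastic condition. -/
def stoMon : Submonoid (Matrix (Fin 3) (Fin 3) ℝ) where
  carrier := {A | (1 : Fin 3 → ℝ) ᵥ* A = 1}
  one_mem' := by simp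
  mul_mem' := by
    intro A B hA hB
    simp only [Set.mem_ofPred_eq] at *
    rw [← Matrix.vecMul_vecMul, hA, hB]

theorem good_nonneg {A : Matrix (Fin 3) (Fin 3) ℝ} (hA : A ∈ goodMon) {v : Fin 3 → ℝ}
    (hv : ∀ j, 0 ≤ v j) : ∀ j, 0 ≤ (A *ᵥ v) j := by
  intro j
  simp only [Matrix.mulVec, dotProduct]
  exact Finset.sum_nonneg fun l _ => mul_nonneg (hA.1 j l) (hv l)

theorem good_ne {A : Matrix (Fin 3) (Fin 3) ℝ} (hA : A.det ≠ 0) {v : Fin 3 → ℝ}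
    (hv : v ≠ 0) : A *ᵥ v ≠ 0 := fun h =>
  hA (Matrix.exists_mulVec_eq_zero_iff.1 ⟨v, hv, h⟩)

theorem det_inj {A : Matrix (Fin 3) (Fin 3) ℝ} (hA : A.det ≠ 0) {v w : Fin 3 → ℝ}
    (h : A *ᵥ v = A *ᵥ w) : v = w := by
  by_contra hne
  apply good_ne hA (sub_ne_zero.2 hne)
  rw [Matrix.mulVec_sub, h, sub_self]

theorem Vmat_det : Vmat.det ≠ 0 := by
  simp [Vmat, Matrix.det_fin_three]

theorem Vmat_zero (y : Fin 3 → ℝ) : (Vmat *ᵥ y) 0 = y 0 + y 1 + y 2 := by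
  simp [Vmat, Matrix.mulVec, dotProduct, Fin.sum_univ_three]

theorem sum_pos_of {y : Fin 3 → ℝ} (hy : ∀ j, 0 ≤ y j) (h : y ≠ 0) : 0 < y 0 + y 1 + y 2 := by
  have h0 := hy 0
  have h1 := hy 1
  have h2 := hy 2
  rcases lt_or_eq_of_le (add_nonneg (add_nonneg h0 h1) h2) with h' | h'
  · exact h'
  · exfalso
    apply h
    ext k
    fin_cases k <;> simp <;> linarith

theorem V_pos {A : Matrix (Fin 3) (Fin 3) ℝ} (hA : A ∈ goodMon) {v : Fin 3 → ℝ}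
    (hv : ∀ j, 0 ≤ v j) (h : v ≠ 0) : 0 < ((Vmat * A) *ᵥ v) 0 := by
  rw [← Matrix.mulVec_mulVec, Vmat_zero]
  exact sum_pos_of (good_nonneg hA hv) (good_ne hA.2 h)

theorem V_row_pos {A : Matrix (Fin 3) (Fin 3) ℝ} (hA : A ∈ goodMon) (j : Fin 3) :
    0 < (Vmat * A) 0 j := by
  have := V_pos hA (v := Pi.single j 1) (fun l => by
    by_cases h : l = j
    · subst h; simp
    · simp [h]) (by simp)
  simpa using this

theorem prodSeq_mem (T : Submonoid (Matrix (Fin 3) (Fin 3) ℝ))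
    (C : Fin 2 → Matrix (Fin 3) (Fin 3) ℝ) (hC : ∀ b, C b ∈ T) (i : ℕ → Fin 2) (n : ℕ) :
    prodSeq C i n ∈ T := by
  induction n with
  | zero => exact T.one_mem
  | succ n ih => exact T.mul_mem ih (hC _)

theorem prodSeq_add (C : Fin 2 → Matrix (Fin 3) (Fin 3) ℝ) (i : ℕ → Fin 2) (n m : ℕ) :
    prodSeq C i (n + m) = prodSeq C i n * prodSeq C (fun l => i (n + l)) m := by
  induction m with
  | zero => simp [prodSeq]
  | succ m ih => rw [← add_assoc, prodSeq, ih, prodSeq, mul_assoc, add_assoc]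

theorem prodSeq_congr (C : Fin 2 → Matrix (Fin 3) (Fin 3) ℝ) (i j : ℕ → Fin 2)
    (h : ∀ n, i (n + 1) = j (n + 1)) (n : ℕ) : prodSeq C i n = prodSeq C j n := by
  induction n with
  | zero => rfl
  | succ n ih => rw [prodSeq, prodSeq, ih, h]

theorem prodSeq_per (C : Fin 2 → Matrix (Fin 3) (Fin 3) ℝ) (j : ℕ → Fin 2) (per : ℕ)
    (h : ∀ n, j (n + 1 + per) = j (n + 1)) (m : ℕ) :
    prodSeq C j (m * per) = prodSeq C j per ^ m := by
  induction m with
  | zero => simp [prodSeq]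
  | succ m ih =>
    rw [Nat.succ_mul, add_comm, prodSeq_add, pow_succ', ← ih]
    congr 1
    apply prodSeq_congr
    intro n
    rw [← h n, add_comm]

theorem exists_eps (u v : Fin 3 → ℝ) (hu : ∀ j, 0 ≤ u j) (hv : ∀ j, u j = 0 → v j = 0) :
    ∃ ε : ℝ, 0 < ε ∧ ∀ j, 0 ≤ u j + ε * v j := by
  have key : ∀ j, ∃ e : ℝ, 0 < e ∧ ∀ ε, 0 < ε → ε ≤ e → 0 ≤ u j + ε * v j := by
    intro j
    rcases (hu j).eq_or_lt with h | h
    · exact ⟨1, one_pos, fun ε _ _ => by rw [hv j h.symm, ← h]; simp⟩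
    · refine ⟨u j / (|v j| + 1), by positivity, fun ε he hle => ?_⟩
      rw [le_div_iff₀ (by positivity)] at hle
      have := neg_abs_le (v j)
      nlinarith
  choose e he hk using key
  refine ⟨min (e 0) (min (e 1) (e 2)), by simp [he], fun j => hk j _ (by simp [he]) ?_⟩
  fin_cases j <;> simp

theorem core (C : Fin 2 → Matrix (Fin 3) (Fin 3) ℝ) (hg : ∀ b, C b ∈ goodMon)
    (hr : ∀ b, C b ∈ ratMon) (i : ℕ → Fin 2)
    (hper : ∃ k : ℕ, 1 ≤ k ∧ ∃ per : ℕ, 1 ≤ per ∧ ∀ n : ℕ, k ≤ n → i (n + per) = i n)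
    (α β : ℝ) (hF : (⋂ n : ℕ, subTri C i (n + 1)) = {(α, β)}) :
    ∃ (W : Matrix (Fin 3) (Fin 3) ℝ) (u : Fin 3 → ℝ) (μ : ℝ),
      (∀ T : Submonoid (Matrix (Fin 3) (Fin 3) ℝ), (∀ b, C b ∈ T) → W ∈ T) ∧
      (∀ j, 0 ≤ u j) ∧ u ≠ 0 ∧ W *ᵥ u = μ • u ∧
      ∀ K : IntermediateField ℚ ℝ, μ ∈ K → α ∈ K ∧ β ∈ K := by
  obtain ⟨k, hk, per, hper1, hp⟩ := hper
  obtain ⟨N, rfl⟩ : ∃ N, k = N + 1 := ⟨k - 1, by omega⟩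
  set A := prodSeq C i N with hA
  set W := prodSeq C (fun l => i (N + l)) per with hW
  have hAg : A ∈ goodMon := prodSeq_mem _ C hg _ _
  have hWg : W ∈ goodMon := prodSeq_mem _ C hg _ _
  have hpow : ∀ m, prodSeq C i (N + m * per) = A * W ^ m := by
    intro m
    rw [prodSeq_add, prodSeq_per]
    intro n
    rw [← hp (N + (n + 1)) (by omega)]
    congr 1
    ring
  have hVA : (Vmat * A).det ≠ 0 := by
    rw [Matrix.det_mul]; exact mul_ne_zero Vmat_det hAg.2
  -- cone membership of the limit point
  have hx : ∀ n, ∃ w : Fin 3 → ℝ, (∀ j, 0 ≤ w j) ∧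
      (Vmat * prodSeq C i (n + 1)) *ᵥ w = ![1, α, β] := by
    intro n
    have h1 : ((α, β) : ℝ × ℝ) ∈ ⋂ n : ℕ, subTri C i (n + 1) := by rw [hF]; rfl
    exact cone_of_mem_hull _ (fun j => V_row_pos (prodSeq_mem _ C hg _ _) j) _
      (Set.mem_iInter.1 h1 n)
  have hx' : ∀ n, ∃ w : Fin 3 → ℝ, (∀ j, 0 ≤ w j) ∧
      (Vmat * prodSeq C i n) *ᵥ w = ![1, α, β] := by
    intro n
    obtain ⟨w, hw, h⟩ := hx n
    refine ⟨C (i (n + 1)) *ᵥ w, good_nonneg (hg _) hw, ?_⟩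
    rw [Matrix.mulVec_mulVec, mul_assoc]
    exact h
  obtain ⟨u, hu, hux⟩ := hx' N
  rw [← hA] at hux
  have hum : ∀ m, ∃ w : Fin 3 → ℝ, (∀ j, 0 ≤ w j) ∧ u = W ^ m *ᵥ w := by
    intro m
    obtain ⟨w, hw, h⟩ := hx' (N + m * per)
    refine ⟨w, hw, det_inj hVA ?_⟩
    rw [hux, Matrix.mulVec_mulVec, mul_assoc, ← hpow, h]
  have hu0 : u ≠ 0 := by
    rintro rfl
    have := congrFun hux 0
    simp at this
  -- uniqueness of the ray
  have huniq : ∀ v : Fin 3 → ℝ, (∀ j, 0 ≤ v j) → v ≠ 0 →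
      (∀ m, ∃ w : Fin 3 → ℝ, (∀ j, 0 ≤ w j) ∧ v = W ^ m *ᵥ w) → ∃ c : ℝ, 0 < c ∧ v = c • u := by
    intro v hv hv0 hvm
    have hy := V_pos hAg hv hv0
    have hmem : projPt ((Vmat * A) *ᵥ v) ∈ ⋂ n : ℕ, subTri C i (n + 1) := by
      rw [Set.mem_iInter]
      intro n
      obtain ⟨w, hw, h⟩ := hvm (n + 1)
      obtain ⟨d, hd⟩ : ∃ d, N + (n + 1) * per = (n + 1) + d :=
        ⟨N + (n + 1) * per - (n + 1), by
          have : (n + 1) * 1 ≤ (n + 1) * per := Nat.mul_le_mul_left _ hper1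
          omega⟩
      have e : (Vmat * A) *ᵥ v = (Vmat * prodSeq C i (n + 1)) *ᵥ
          (prodSeq C (fun l => i (n + 1 + l)) d *ᵥ w) := by
        rw [h, Matrix.mulVec_mulVec, Matrix.mulVec_mulVec, mul_assoc, mul_assoc, ← hpow, hd,
          prodSeq_add]
      rw [e] at hy ⊢
      exact mem_hull_of_cone _ (fun j => V_row_pos (prodSeq_mem _ C hg _ _) j) _
        (good_nonneg (prodSeq_mem _ C hg _ _) hw) hy
    rw [hF, Set.mem_singleton_iff, projPt, Prod.mk.injEq] at hmem
    refine ⟨_, hy, det_inj hVA ?_⟩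
    rw [Matrix.mulVec_smul, hux]
    obtain ⟨h1, h2⟩ := hmem
    rw [div_eq_iff hy.ne'] at h1 h2
    ext l
    fin_cases l
    · simp
    · simp [h1, mul_comm]
    · simp [h2, mul_comm]
  obtain ⟨μ, hμ, hWu⟩ := huniq (W *ᵥ u) (good_nonneg hWg hu) (good_ne hWg.2 hu0) (by
    intro m
    obtain ⟨w, hw, h⟩ := hum m
    refine ⟨W *ᵥ w, good_nonneg hWg hw, ?_⟩
    rw [h, Matrix.mulVec_mulVec, Matrix.mulVec_mulVec, ← pow_succ, ← pow_succ'])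
  -- the linear system pins down the ray
  have hker : ∀ v : Fin 3 → ℝ, W *ᵥ v = μ • v → (∀ j, u j = 0 → v j = 0) →
      ∃ c : ℝ, v = c • u := by
    intro v hv hvz
    obtain ⟨ε, hε, hnn⟩ := exists_eps u v hu hvz
    have hsum : ∃ c : ℝ, u + ε • v = c • u := by
      by_cases h0 : u + ε • v = 0
      · exact ⟨0, by simp [h0]⟩
      · obtain ⟨c, _, hc⟩ := huniq (u + ε • v) (by simpa using hnn) h0 (by
          intro m
          have hz : ∀ m, W ^ m *ᵥ (u + ε • v) = μ ^ m • (u + ε • v) := by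
            intro m
            induction m with
            | zero => simp
            | succ m ih =>
              rw [pow_succ, ← Matrix.mulVec_mulVec, Matrix.mulVec_add, Matrix.mulVec_smul, hWu, hv,
                smul_comm ε μ, ← smul_add, Matrix.mulVec_smul, ih, smul_smul, pow_succ']
          refine ⟨(μ ^ m)⁻¹ • (u + ε • v), fun j => ?_, ?_⟩
          · have := hnn j
            simp only [Pi.smul_apply, Pi.add_apply, smul_eq_mul]
            positivity
          · rw [Matrix.mulVec_smul, hz, smul_smul, inv_mul_cancel₀ (by positivity), one_smul])
        exact ⟨c, hc⟩
    obtain ⟨c, hc⟩ := hsum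
    refine ⟨ε⁻¹ * (c - 1), ?_⟩
    rw [mul_smul, sub_smul, one_smul, ← hc, add_sub_cancel_left, smul_smul,
      inv_mul_cancel₀ hε.ne', one_smul]
  refine ⟨W, u, μ, fun T hT => prodSeq_mem T C hT _ _, hu, hu0, hWu, fun K hK => ?_⟩
  -- descend to K
  obtain ⟨j0, hj0⟩ : ∃ j, u j ≠ 0 := Function.ne_iff.1 hu0
  obtain ⟨φ, hφ⟩ : ∃ φ : Module.Dual K ℝ, φ (u j0) ≠ 0 := by
    by_contra hcon
    push Not at hcon
    exact hj0 ((Module.forall_dual_apply_eq_zero_iff K (u j0)).1 hcon)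
  have hφm : ∀ a : ℝ, a ∈ K → ∀ x : ℝ, ((φ (a * x) : K) : ℝ) = a * (φ x : K) := by
    intro a ha x
    have := φ.map_smul (⟨a, ha⟩ : K) x
    have h2 : (⟨a, ha⟩ : K) • x = a * x := rfl
    rw [h2] at this
    rw [this]
    rfl
  have hratK : ∀ B ∈ ratMon, ∀ a b, B a b ∈ K := by
    rintro _ ⟨B, rfl⟩ a b
    simp only [Matrix.map_apply]
    exact K.algebraMap_mem _
  have hWK := hratK W (prodSeq_mem _ C hr _ _)
  have hVr : Vmat ∈ ratMon := ⟨!![1,1,1; 0,1,1; 0,0,1], by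
    ext a b; fin_cases a <;> fin_cases b <;> simp [Vmat]⟩
  have hVAK := hratK (Vmat * A) (ratMon.mul_mem hVr (prodSeq_mem _ C hr _ _))
  set w : Fin 3 → ℝ := fun j => ((φ (u j) : K) : ℝ) with hw
  obtain ⟨c, hc⟩ := hker w (by
    ext l
    have h := congrFun hWu l
    simp only [Matrix.mulVec, dotProduct, Fin.sum_univ_three, Pi.smul_apply, smul_eq_mul] at h ⊢
    simp only [hw]
    rw [← hφm _ hK, ← h, map_add, map_add]
    push_cast
    rw [hφm _ (hWK _ _), hφm _ (hWK _ _), hφm _ (hWK _ _)]) (by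
    intro j hj
    simp [hw, hj])
  have hc0 : c ≠ 0 := by
    rintro rfl
    have := congrFun hc j0
    simp only [hw, zero_smul, Pi.zero_apply] at this
    exact hφ (by exact_mod_cast this)
  have hwK : ∀ l, ((Vmat * A) *ᵥ w) l ∈ K := by
    intro l
    simp only [Matrix.mulVec, dotProduct]
    exact K.sum_mem fun j _ => K.mul_mem (hVAK _ _) (φ (u j)).2
  rw [hc, Matrix.mulVec_smul, hux] at hwK
  have h0 : c ∈ K := by simpa using hwK 0
  have h1 : c * α ∈ K := by simpa using hwK 1
  have h2 : c * β ∈ K := by simpa using hwK 2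
  constructor
  · have := K.mul_mem (K.inv_mem h0) h1
    rwa [inv_mul_cancel_left₀ hc0] at this
  · have := K.mul_mem (K.inv_mem h0) h2
    rwa [inv_mul_cancel_left₀ hc0] at this

theorem permMat_good (p : Equiv.Perm (Fin 3)) : permMat p ∈ goodMon := by
  refine ⟨fun i j => ?_, ?_⟩
  · simp only [permMat, Matrix.of_apply]; split_ifs <;> norm_num
  · have h : permMat p * permMat p⁻¹ = 1 := by
      ext a b
      simp only [permMat, Matrix.mul_apply, Matrix.of_apply, Matrix.one_apply]
      rw [Finset.sum_eq_single (p⁻¹ b)]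
      · simp [eq_comm]
      · intro l _ hl
        rw [if_neg (show ¬ (p⁻¹ b = l) from fun h => hl h.symm), mul_zero]
      · simp
    have h2 := congrArg Matrix.det h
    rw [Matrix.det_mul, Matrix.det_one] at h2
    exact left_ne_zero_of_mul_eq_one h2

theorem permMat_rat (p : Equiv.Perm (Fin 3)) : permMat p ∈ ratMon :=
  ⟨Matrix.of fun i j => if p j = i then 1 else 0, by
    ext a b
    simp only [permMat, Matrix.map_apply, Matrix.of_apply]
    split_ifs <;> simp⟩

theorem permMat_sto (p : Equiv.Perm (Fin 3)) : permMat p ∈ stoMon := by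
  change (1 : Fin 3 → ℝ) ᵥ* permMat p = 1
  ext b
  simp [Matrix.vecMul, dotProduct, permMat]

theorem trip_mem (T : Submonoid (Matrix (Fin 3) (Fin 3) ℝ)) {a b c d e : Matrix (Fin 3) (Fin 3) ℝ}
    (ha : a ∈ T) (hb : b ∈ T) (hc : c ∈ T) (hd : d ∈ T) (he : e ∈ T) (l : Fin 2) :
    (![a * d * b, a * e * c] : Fin 2 → Matrix (Fin 3) (Fin 3) ℝ) l ∈ T := by
  fin_cases l
  · exact T.mul_mem (T.mul_mem ha hd) hb
  · exact T.mul_mem (T.mul_mem ha he) hc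

theorem F0_good : F0 ∈ goodMon := by
  refine ⟨fun a b => ?_, ?_⟩
  · fin_cases a <;> fin_cases b <;> simp [F0]
  · simp [F0, Matrix.det_fin_three]
theorem F1_good : F1 ∈ goodMon := by
  refine ⟨fun a b => ?_, ?_⟩
  · fin_cases a <;> fin_cases b <;> simp [F1]
  · simp [F1, Matrix.det_fin_three]
theorem G0_good : G0 ∈ goodMon := by
  refine ⟨fun a b => ?_, ?_⟩
  · fin_cases a <;> fin_cases b <;> simp [G0]
  · simp [G0, Matrix.det_fin_three]
theorem G1_good : G1 ∈ goodMon := by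
  refine ⟨fun a b => ?_, ?_⟩
  · fin_cases a <;> fin_cases b <;> simp [G1]
  · simp [G1, Matrix.det_fin_three]
theorem F0_rat : F0 ∈ ratMon := ⟨!![0,0,1; 1,0,0; 0,1,1], by
  ext a b; fin_cases a <;> fin_cases b <;> simp [F0]⟩
theorem F1_rat : F1 ∈ ratMon := ⟨!![1,0,1; 0,1,0; 0,0,1], by
  ext a b; fin_cases a <;> fin_cases b <;> simp [F1]⟩
theorem G0_rat : G0 ∈ ratMon := ⟨!![0,0,1/2; 1,0,0; 0,1,1/2], by
  ext a b; fin_cases a <;> fin_cases b <;> simp [G0]⟩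
theorem G1_rat : G1 ∈ ratMon := ⟨!![1,0,1/2; 0,1,0; 0,0,1/2], by
  ext a b; fin_cases a <;> fin_cases b <;> simp [G1]⟩
theorem G0_sto : G0 ∈ stoMon := by
  change (1 : Fin 3 → ℝ) ᵥ* G0 = 1
  ext b
  fin_cases b <;> simp [Matrix.vecMul, dotProduct, G0, Fin.sum_univ_three] <;> norm_num
theorem G1_sto : G1 ∈ stoMon := by
  change (1 : Fin 3 → ℝ) ᵥ* G1 = 1
  ext b
  fin_cases b <;> simp [Matrix.vecMul, dotProduct, G1, Fin.sum_univ_three] <;> norm_num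

theorem rank_adjoin_le (W : Matrix (Fin 3) (Fin 3) ℝ) (hW : W ∈ ratMon) (u : Fin 3 → ℝ)
    (hu : u ≠ 0) (μ : ℝ) (h : W *ᵥ u = μ • u) :
    Module.rank ℚ (IntermediateField.adjoin ℚ {μ}) ≤ 3 := by
  obtain ⟨B, rfl⟩ := hW
  have hdet : (Matrix.scalar (Fin 3) μ - B.map (algebraMap ℚ ℝ)).det = 0 := by
    rw [← Matrix.exists_mulVec_eq_zero_iff]
    refine ⟨u, hu, ?_⟩
    rw [Matrix.sub_mulVec, h, sub_eq_zero]
    ext j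
    simp [Matrix.scalar_apply, Matrix.mulVec_diagonal]
  rw [← Matrix.eval_charpoly, Matrix.charpoly_map, Polynomial.eval_map_algebraMap] at hdet
  have hmon := B.charpoly_monic
  have hint : IsIntegral ℚ μ := ⟨B.charpoly, hmon, hdet⟩
  have hdeg : (minpoly ℚ μ).natDegree ≤ 3 := by
    have := Polynomial.natDegree_le_of_dvd (minpoly.dvd ℚ μ hdet) hmon.ne_zero
    rwa [Matrix.charpoly_natDegree_eq_dim, Fintype.card_fin] at this
  have : FiniteDimensional ℚ (IntermediateField.adjoin ℚ {μ}) :=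
    IntermediateField.adjoin.finiteDimensional hint
  rw [← Module.finrank_eq_rank, IntermediateField.adjoin.finrank hint]
  exact_mod_cast hdeg

/-- If an eventually periodic sequence has its nested Farey triangles converge to (α,β)
and its nested barycentric triangles converge to (r,s), then α, β lie in a common
subfield K of ℝ with [K : ℚ] ≤ 3, and r, s are rational. -/
theorem stmt4 (p q r' : Equiv.Perm (Fin 3)) (i : ℕ → Fin 2)
    (hper : ∃ k : ℕ, 1 ≤ k ∧ ∃ per : ℕ, 1 ≤ per ∧ ∀ n : ℕ, k ≤ n → i (n + per) = i n)
    (α β r s : ℝ)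
    (hF : (⋂ n : ℕ, subTri (Ftrip (permMat p) (permMat q) (permMat r')) i (n + 1))
      = {(α, β)})
    (hG : (⋂ n : ℕ, subTri (Gtrip (permMat p) (permMat q) (permMat r')) i (n + 1))
      = {(r, s)}) :
    (∃ K : IntermediateField ℚ ℝ, Module.rank ℚ K ≤ 3 ∧ α ∈ K ∧ β ∈ K) ∧
    (∃ a : ℚ, (a : ℝ) = r) ∧ (∃ b : ℚ, (b : ℝ) = s) := by
  have hFg : ∀ b, Ftrip (permMat p) (permMat q) (permMat r') b ∈ goodMon :=
    trip_mem _ (permMat_good p) (permMat_good q) (permMat_good r') F0_good F1_good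
  have hFr : ∀ b, Ftrip (permMat p) (permMat q) (permMat r') b ∈ ratMon :=
    trip_mem _ (permMat_rat p) (permMat_rat q) (permMat_rat r') F0_rat F1_rat
  have hGg : ∀ b, Gtrip (permMat p) (permMat q) (permMat r') b ∈ goodMon :=
    trip_mem _ (permMat_good p) (permMat_good q) (permMat_good r') G0_good G1_good
  have hGr : ∀ b, Gtrip (permMat p) (permMat q) (permMat r') b ∈ ratMon :=
    trip_mem _ (permMat_rat p) (permMat_rat q) (permMat_rat r') G0_rat G1_rat
  have hGs : ∀ b, Gtrip (permMat p) (permMat q) (permMat r') b ∈ stoMon :=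
    trip_mem _ (permMat_sto p) (permMat_sto q) (permMat_sto r') G0_sto G1_sto
  constructor
  · obtain ⟨W, u, μ, hW, hu, hu0, hWu, hK⟩ := core _ hFg hFr i hper α β hF
    have := hK (IntermediateField.adjoin ℚ {μ}) (IntermediateField.mem_adjoin_simple_self ℚ μ)
    exact ⟨_, rank_adjoin_le W (hW _ hFr) u hu0 μ hWu, this.1, this.2⟩
  · obtain ⟨W, u, μ, hW, hu, hu0, hWu, hK⟩ := core _ hGg hGr i hper r s hG
    have hs : (1 : Fin 3 → ℝ) ᵥ* W = 1 := hW _ hGs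
    have hμ : μ = 1 := by
      have h := congrArg (fun z => (1 : Fin 3 → ℝ) ⬝ᵥ z) hWu
      simp only [Matrix.dotProduct_mulVec, hs, dotProduct_smul, smul_eq_mul] at h
      have hpos : 0 < (1 : Fin 3 → ℝ) ⬝ᵥ u := by
        simpa [dotProduct, Fin.sum_univ_three] using sum_pos_of hu hu0
      exact (mul_right_cancel₀ hpos.ne' (by rw [one_mul]; exact h)).symm
    have := hK ⊥ (by rw [hμ]; exact one_mem _)
    rw [IntermediateField.mem_bot, IntermediateField.mem_bot] at this
    obtain ⟨⟨a, ha⟩, ⟨b, hb⟩⟩ := this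
    exact ⟨⟨a, by simpa using ha⟩, ⟨b, by simpa using hb⟩⟩
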